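/- arXiv:1407.3254 — 2 statements merged into one kernel-verified Lean document; each statement's English description precedes it below -/
import Mathlib

section
/- Let S ⊆ [m]×[n] be a pattern such that {1,…,p}×{1,…,q} is a block of specified entries, i.e. S ∩ (({1,…,p}×[n]) ∪ ([m]×{1,…,q})) = {1,…,p}×{1,…,q}. Let M be a partial matrix subordinate to S with all specified entries positive such that the p×q submatrix (m_{ij})_{i≤p, j≤q} has rank one. Let M̂ be the partial matrix on [m−p+1]×[n−q+1] obtained by contracting rows 1,…,p to a single row and columns 1,…,q to a single column, whose (1,1) entry is ∑_{i=1}^p ∑_{j=1}^q m_{ij} and whose other specified entries are the corresponding specified entries of M. Then M is completable to a rank-one matrix in the standard simplex Δ^{mn−1} if and only if M̂ is completable to a rank-one matrix in the standard simplex Δ^{(m−p+1)(n−q+1)−1}. -/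
/-- The `2 × 2` minors of a matrix of rank at most one vanish. -/
theorem Matrix.mul_eq_mul_of_rank_le_one {ι κ K : Type*} [Finite ι] [Fintype κ] [Field K]
    {A : Matrix ι κ K} (hA : A.rank ≤ 1) (i k : ι) (j l : κ) :
    A i j * A k l = A i l * A k j := by
  classical
  obtain ⟨v, hv⟩ := finrank_le_one_iff.1 hA
  have col (j : κ) : ∃ c : K, ∀ i, A i j = c * (v : ι → K) i := by
    obtain ⟨c, hc⟩ := hv ⟨A.mulVecLin (Pi.single j 1), LinearMap.mem_range_self _ _⟩
    refine ⟨c, fun i => ?_⟩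
    simpa using (congrFun (congrArg Subtype.val hc) i).symm
  obtain ⟨c, hc⟩ := col j
  obtain ⟨d, hd⟩ := col l
  rw [hc, hc, hd, hd]
  ring

/-- A matrix of rank at most one is, up to its total sum, the product of its marginals. -/
theorem Matrix.mul_sum_eq_of_rank_le_one {ι κ K : Type*} [Fintype ι] [Fintype κ] [Field K]
    {A : Matrix ι κ K} (hA : A.rank ≤ 1) (i : ι) (j : κ) :
    A i j * ∑ k, ∑ l, A k l = (∑ l, A i l) * ∑ k, A k j := by
  rw [Finset.sum_mul_sum, Finset.sum_comm, Finset.mul_sum]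
  refine Finset.sum_congr rfl fun k _ => ?_
  rw [Finset.mul_sum]
  exact Finset.sum_congr rfl fun l _ => Matrix.mul_eq_mul_of_rank_le_one hA i k j l

/-- The rank-one matrices in the standard simplex are the products of two points of standard
simplices. -/
theorem exists_rank_one_simplex_iff {ι κ : Type*} [Fintype ι] [Fintype κ]
    (P : Matrix ι κ ℝ → Prop) :
    (∃ M : Matrix ι κ ℝ, (∀ i j, 0 ≤ M i j) ∧ (∑ i, ∑ j, M i j = 1) ∧ M.rank = 1 ∧ P M) ↔
      ∃ r ∈ stdSimplex ℝ ι, ∃ c ∈ stdSimplex ℝ κ, P (Matrix.vecMulVec r c) := by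
  constructor
  · rintro ⟨M, hM, hsum, hrank, hP⟩
    refine ⟨fun i => ∑ j, M i j, ⟨fun i => Finset.sum_nonneg fun j _ => hM i j, hsum⟩,
      fun j => ∑ i, M i j, ⟨fun j => Finset.sum_nonneg fun i _ => hM i j, ?_⟩, ?_⟩
    · rw [Finset.sum_comm, hsum]
    · convert hP
      ext i j
      rw [Matrix.vecMulVec_apply, ← Matrix.mul_sum_eq_of_rank_le_one hrank.le, hsum, mul_one]
  · rintro ⟨r, ⟨hr, hr1⟩, c, ⟨hc, hc1⟩, hP⟩
    have hsum : ∑ i, ∑ j, Matrix.vecMulVec r c i j = 1 := by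
      simp only [Matrix.vecMulVec_apply]
      rw [← Finset.sum_mul_sum, hr1, hc1, one_mul]
    refine ⟨Matrix.vecMulVec r c, fun i j => mul_nonneg (hr i) (hc j), hsum, ?_, hP⟩
    refine le_antisymm (Matrix.rank_vecMulVec_le r c) (Nat.one_le_iff_ne_zero.2 fun h => ?_)
    have hrange := LinearMap.range_eq_bot.1 (Submodule.finrank_eq_zero.1 h)
    have hrow (i : ι) : ∑ j, Matrix.vecMulVec r c i j = 0 := by
      simpa [Matrix.mulVec, dotProduct] using congrFun (LinearMap.congr_fun hrange 1) i
    simp [hrow] at hsum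

theorem Fin.sum_univ_eq_sum_castLE_add {m p : ℕ} (hpm : p ≤ m) (g : Fin m → ℝ) :
    ∑ i, g i = ∑ i : Fin p, g (Fin.castLE hpm i) +
      ∑ k : Fin (m - p), g ⟨p + k, by have := k.isLt; omega⟩ := by
  obtain ⟨d, rfl⟩ := Nat.exists_eq_add_of_le hpm
  rw [Fin.sum_univ_add]
  congr 1
  exact (Fintype.sum_equiv (finCongr (Nat.add_sub_cancel_left (n := p) (m := d))) _ _
    fun _ => rfl).symm

/-- Merging the first `p` coordinates of a point of the simplex. -/
theorem exists_stdSimplex_merge {m p : ℕ} (hpm : p ≤ m) {r : Fin m → ℝ}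
    (hr : r ∈ stdSimplex ℝ (Fin m)) :
    ∃ s ∈ stdSimplex ℝ (Fin (m - p + 1)),
      s 0 = ∑ i : Fin p, r (Fin.castLE hpm i) ∧
      ∀ i : Fin m, p ≤ (i : ℕ) → ∀ h, s ⟨(i : ℕ) - p + 1, h⟩ = r i := by
  refine ⟨Fin.cons (∑ i : Fin p, r (Fin.castLE hpm i))
    fun k : Fin (m - p) => r ⟨p + k, by have := k.isLt; omega⟩, ⟨fun k => ?_, ?_⟩, rfl,
    fun i hi h => ?_⟩
  · refine Fin.cases ?_ (fun k => ?_) k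
    · rw [Fin.cons_zero]
      exact Finset.sum_nonneg fun i _ => hr.1 _
    · exact hr.1 _
  · rw [Fin.sum_univ_succ, ← hr.2, Fin.sum_univ_eq_sum_castLE_add hpm]
    rfl
  · change r ⟨p + (i - p), _⟩ = r i
    congr 1
    ext
    exact Nat.add_sub_cancel' hi

/-- Splitting the first coordinate of a point of the simplex according to given proportions. -/
theorem exists_stdSimplex_split {m p : ℕ} (hpm : p ≤ m) {a : Fin p → ℝ}
    (ha : a ∈ stdSimplex ℝ (Fin p)) {s : Fin (m - p + 1) → ℝ}
    (hs : s ∈ stdSimplex ℝ (Fin (m - p + 1))) :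
    ∃ r ∈ stdSimplex ℝ (Fin m),
      (∀ i : Fin p, r (Fin.castLE hpm i) = a i * s 0) ∧
      ∀ i : Fin m, p ≤ (i : ℕ) → ∀ h, r i = s ⟨(i : ℕ) - p + 1, h⟩ := by
  let r : Fin m → ℝ := fun i =>
    if h : (i : ℕ) < p then a ⟨i, h⟩ * s 0
    else s ⟨(i : ℕ) - p + 1, by have := i.isLt; omega⟩
  have hlow (i : Fin p) : r (Fin.castLE hpm i) = a i * s 0 := dif_pos i.isLt
  have hhigh (i : Fin m) (hi : p ≤ (i : ℕ)) (h) : r i = s ⟨(i : ℕ) - p + 1, h⟩ :=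
    dif_neg hi.not_gt
  refine ⟨r, ⟨fun i => ?_, ?_⟩, hlow, hhigh⟩
  · by_cases h : (i : ℕ) < p
    · exact (hlow ⟨i, h⟩).symm ▸ mul_nonneg (ha.1 _) (hs.1 _)
    · rw [hhigh i (not_lt.1 h) (by have := i.isLt; omega)]
      exact hs.1 _
  · rw [Fin.sum_univ_eq_sum_castLE_add hpm, ← hs.2, Fin.sum_univ_succ]
    congr 1
    · simp_rw [hlow]
      rw [← Finset.sum_mul, ha.2, one_mul]
    · refine Finset.sum_congr rfl fun k _ => ?_
      rw [hhigh _ (Nat.le_add_right p k) (by have := k.isLt; simp)]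
      congr 1
      ext
      simp

/-- Contracting a rank-one block of positively specified entries to a single entry
(equal to the sum of the block entries) preserves completability to a rank-one
matrix in the standard simplex. -/
theorem block_contraction_completable_iff (m n p q : ℕ)
    (hp : 1 ≤ p) (hpm : p ≤ m) (hq : 1 ≤ q) (hqn : q ≤ n)
    (S : Set (Fin m × Fin n)) (f : Fin m → Fin n → ℝ)
    (hblock : ∀ i j, ((i, j) ∈ S ∧ ((i : ℕ) < p ∨ (j : ℕ) < q)) ↔
      ((i : ℕ) < p ∧ (j : ℕ) < q))
    (hpos : ∀ i j, (i, j) ∈ S → 0 < f i j)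
    (hrank : Matrix.rank (Matrix.of fun (i : Fin p) (j : Fin q) =>
      f (Fin.castLE hpm i) (Fin.castLE hqn j)) = 1) :
    (∃ M : Matrix (Fin m) (Fin n) ℝ,
      (∀ i j, 0 ≤ M i j) ∧ (∑ i, ∑ j, M i j = 1) ∧ M.rank = 1 ∧
      ∀ i j, (i, j) ∈ S → M i j = f i j) ↔
    (∃ N : Matrix (Fin (m - p + 1)) (Fin (n - q + 1)) ℝ,
      (∀ i j, 0 ≤ N i j) ∧ (∑ i, ∑ j, N i j = 1) ∧ N.rank = 1 ∧
      N ⟨0, by omega⟩ ⟨0, by omega⟩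
        = ∑ i : Fin p, ∑ j : Fin q, f (Fin.castLE hpm i) (Fin.castLE hqn j) ∧
      ∀ i j, (i, j) ∈ S → ∀ (hi : p ≤ (i : ℕ)) (hj : q ≤ (j : ℕ)),
        N ⟨(i : ℕ) - p + 1, by have := i.isLt; omega⟩
          ⟨(j : ℕ) - q + 1, by have := j.isLt; omega⟩ = f i j) := by
  have hS (i : Fin p) (j : Fin q) : (Fin.castLE hpm i, Fin.castLE hqn j) ∈ S :=
    ((hblock _ _).2 ⟨i.isLt, j.isLt⟩).1
  rw [exists_rank_one_simplex_iff fun M => ∀ i j, (i, j) ∈ S → M i j = f i j,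
    exists_rank_one_simplex_iff fun N : Matrix (Fin (m - p + 1)) (Fin (n - q + 1)) ℝ =>
      N ⟨0, by omega⟩ ⟨0, by omega⟩
        = ∑ i : Fin p, ∑ j : Fin q, f (Fin.castLE hpm i) (Fin.castLE hqn j) ∧
      ∀ i j, (i, j) ∈ S → ∀ (hi : p ≤ (i : ℕ)) (hj : q ≤ (j : ℕ)),
        N ⟨(i : ℕ) - p + 1, by have := i.isLt; omega⟩
          ⟨(j : ℕ) - q + 1, by have := j.isLt; omega⟩ = f i j]
  constructor
  · rintro ⟨r, hr, c, hc, hM⟩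
    obtain ⟨s, hs, hs0, hsr⟩ := exists_stdSimplex_merge hpm hr
    obtain ⟨t, ht, ht0, htc⟩ := exists_stdSimplex_merge hqn hc
    refine ⟨s, hs, t, ht, ?_, fun i j hij hi hj => ?_⟩
    · change s 0 * t 0 = _
      rw [hs0, ht0, Finset.sum_mul_sum]
      exact Finset.sum_congr rfl fun i _ => Finset.sum_congr rfl fun j _ => hM _ _ (hS i j)
    · rw [Matrix.vecMulVec_apply, hsr i hi, htc j hj]
      exact hM i j hij
  · rintro ⟨s, hs, t, ht, h0, hN⟩
    set B : Matrix (Fin p) (Fin q) ℝ :=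
      Matrix.of fun i j => f (Fin.castLE hpm i) (Fin.castLE hqn j)
    have hBpos (i : Fin p) (j : Fin q) : 0 < B i j := hpos _ _ (hS i j)
    set T : ℝ := ∑ i, ∑ j, B i j
    have hTpos : 0 < T :=
      Finset.sum_pos (fun i _ => Finset.sum_pos (fun j _ => hBpos i j) ⟨⟨0, hq⟩, by simp⟩)
        ⟨⟨0, hp⟩, by simp⟩
    have h0 : s 0 * t 0 = T := h0
    have ha : (fun i => (∑ j, B i j) / T) ∈ stdSimplex ℝ (Fin p) :=
      ⟨fun i => div_nonneg (Finset.sum_nonneg fun j _ => (hBpos i j).le) hTpos.le, by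
        rw [← Finset.sum_div, div_self hTpos.ne']⟩
    have hb : (fun j => (∑ i, B i j) / T) ∈ stdSimplex ℝ (Fin q) :=
      ⟨fun j => div_nonneg (Finset.sum_nonneg fun i _ => (hBpos i j).le) hTpos.le, by
        rw [← Finset.sum_div, Finset.sum_comm, div_self hTpos.ne']⟩
    obtain ⟨r, hr, hr0, hrs⟩ := exists_stdSimplex_split hpm ha hs
    obtain ⟨c, hc, hc0, hct⟩ := exists_stdSimplex_split hqn hb ht
    refine ⟨r, hr, c, hc, fun i j hij => ?_⟩
    by_cases hlow : (i : ℕ) < p ∨ (j : ℕ) < q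
    · obtain ⟨hi, hj⟩ := (hblock i j).1 ⟨hij, hlow⟩
      have hri := hr0 ⟨i, hi⟩
      have hcj := hc0 ⟨j, hj⟩
      change r i = _ at hri
      change c j = _ at hcj
      have hprod := Matrix.mul_sum_eq_of_rank_le_one hrank.le ⟨i, hi⟩ ⟨j, hj⟩
      change f i j * T = _ at hprod
      rw [Matrix.vecMulVec_apply, hri, hcj, mul_mul_mul_comm, h0, div_mul_div_comm, ← hprod]
      field_simp
    · push Not at hlow
      rw [Matrix.vecMulVec_apply, hrs i hlow.1 (by have := i.isLt; omega),
        hct j hlow.2 (by have := j.isLt; omega)]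
      exact hN i j hij hlow.1 hlow.2
end

section
/- Let d ≥ 2 and n ≥ 2. There exists an irreducible polynomial f in ℚ[x_1, …, x_n] of total degree d^{n−1} with constant term 1 such that f vanishes at every point (x_1, …, x_n) ∈ ℝ^n with x_i ≥ 0 for all i and ∑_{i=1}^n x_i^{1/d} = 1; moreover f is the unique (up to this normalization) irreducible polynomial with constant term 1 vanishing on this set. -/
open MvPolynomial

section RadicalForms

variable {ι K : Type*} [Field K]

/-- The affine-linear form `1 - ∑ i, ζ i * X i`. -/
noncomputable def unitForm [Fintype ι] (ζ : ι → K) : MvPolynomial ι K :=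
  1 - ∑ i, C (ζ i) * X i

/-- The substitution `X i ↦ ζ i * X i`. -/
noncomputable def scaleVars (ζ : ι → K) : MvPolynomial ι K →ₐ[K] MvPolynomial ι K :=
  aeval fun i => C (ζ i) * X i

theorem coeff_scaleVars (ζ : ι → K) (p : MvPolynomial ι K) (m : ι →₀ ℕ) :
    (scaleVars ζ p).coeff m = (m.prod fun i k => ζ i ^ k) * p.coeff m := by
  classical
  induction p using MvPolynomial.induction_on' with
  | monomial u a =>
    have h : scaleVars ζ (monomial u a) = monomial u (a * u.prod fun i k => ζ i ^ k) := by
      rw [scaleVars, aeval_monomial]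
      simp only [mul_pow, Finsupp.prod_mul, ← C_pow]
      rw [monomial_eq, C_mul, mul_assoc]
      congr 2
      simp [Finsupp.prod, map_prod]
    rw [h, coeff_monomial, coeff_monomial]
    split_ifs with hu
    · rw [hu, mul_comm]
    · simp
  | add p q hp hq => simp only [map_add, coeff_add, hp, hq, mul_add]

theorem scaleVars_expand {d : ℕ} {ζ : ι → K} (hζ : ∀ i, ζ i ^ d = 1) (p : MvPolynomial ι K) :
    scaleVars ζ (expand d p) = expand d p := by
  have h : (scaleVars ζ).comp (expand d) = expand d := by
    ext1 i
    simp [scaleVars, mul_pow, ← C_pow, hζ]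
  exact DFunLike.congr_fun h p

/-- A polynomial over a Galois extension which is fixed by the Galois group and by scaling the
variables by `d`-th roots of unity is a polynomial in the `d`-th powers of the variables with
coefficients in the base field. -/
theorem exists_map_expand_eq {k : Type*} [Field k] [Algebra k K] [IsGalois k K] {d : ℕ}
    {ω : K} (hω : IsPrimitiveRoot ω d) (P : MvPolynomial ι K)
    (hscale : ∀ ζ : ι → K, (∀ i, ζ i ^ d = 1) → scaleVars ζ P = P)
    (hgal : ∀ τ : Gal(K/k), map (τ : K →+* K) P = P) :
    ∃ p : MvPolynomial ι k, map (algebraMap k K) (expand d p) = P := by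
  classical
  have hq : ∀ m, ∃ q : k, algebraMap k K q = P.coeff m := fun m => by
    refine (InfiniteGalois.mem_range_algebraMap_iff_fixed (P.coeff m)).2 fun τ => ?_
    conv_rhs => rw [← hgal τ, coeff_map]
    rfl
  choose q hq using hq
  have hdvd : ∀ m ∈ P.support, ∀ i, d ∣ m i := fun m hm i => by
    have h := hscale (Function.update 1 i ω) fun j => by
      by_cases hj : j = i
      · subst hj; simpa using hω.pow_eq_one
      · simp [hj]
    have hc := congrArg (coeff m) h
    rw [coeff_scaleVars, mul_eq_right₀ (mem_support_iff.1 hm)] at hc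
    rw [← hω.pow_eq_one_iff_dvd, ← hc, Finsupp.prod]
    by_cases hi : i ∈ m.support
    · rw [Finset.prod_eq_single_of_mem i hi fun j _ hj => by simp [hj]]
      simp
    · rw [Finset.prod_eq_one fun j hj => ?_]
      · simp [Finsupp.notMem_support_iff.1 hi]
      · have : j ≠ i := fun h => hi (h ▸ hj)
        simp [this]
  refine ⟨∑ m ∈ P.support, monomial (m.mapRange (· / d) (Nat.zero_div d)) (q m), ?_⟩
  rw [map_sum, map_sum]
  conv_rhs => rw [← P.support_sum_monomial_coeff]
  refine Finset.sum_congr rfl fun m hm => ?_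
  rw [expand_monomial, map_monomial, hq]
  refine congrArg (monomial · _) (Finsupp.ext fun i => ?_)
  simpa using Nat.mul_div_cancel' (hdvd m hm i)

theorem eq_of_mul_isUnit_of_coeff_zero {R : Type*} [CommRing R] [IsReduced R]
    {p q u : MvPolynomial ι R} (h : q = p * u) (hu : IsUnit u)
    (hp : p.coeff 0 = 1) (hq : q.coeff 0 = 1) : q = p := by
  obtain ⟨c, -, rfl⟩ := isUnit_iff_eq_C_of_isReduced.1 hu
  have hc : c = 1 := by
    rw [h, mul_comm, coeff_C_mul, hp, mul_one] at hq
    exact hq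
  rw [h, hc, C_1, mul_one]

variable [Fintype ι]

theorem scaleVars_unitForm (ζ η : ι → K) : scaleVars η (unitForm ζ) = unitForm (ζ * η) := by
  simp [scaleVars, unitForm, algebraMap_eq, mul_assoc]

theorem coeff_zero_unitForm (ζ : ι → K) : (unitForm ζ).coeff 0 = 1 := by
  simp [unitForm, coeff_sum]

theorem coeff_single_unitForm (ζ : ι → K) (i : ι) :
    (unitForm ζ).coeff (Finsupp.single i 1) = -ζ i := by
  classical
  rw [unitForm, coeff_sub, coeff_sum, Finset.sum_eq_single i]
  · rw [coeff_one, coeff_C_mul, coeff_X, if_neg (by simp [eq_comm]), if_pos rfl, mul_one, zero_sub]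
  · intro j _ hj
    rw [coeff_C_mul, coeff_X, if_neg, mul_zero]
    simpa [Finsupp.single_left_inj] using hj
  · simp

theorem unitForm_injective : Function.Injective (unitForm : (ι → K) → MvPolynomial ι K) := by
  intro ζ η h
  funext i
  simpa [coeff_single_unitForm] using congrArg (coeff (Finsupp.single i 1)) h

theorem totalDegree_unitForm {ζ : ι → K} (hζ : ζ ≠ 0) : (unitForm ζ).totalDegree = 1 := by
  classical
  obtain ⟨i, hi⟩ := Function.ne_iff.1 hζ
  refine le_antisymm ?_ ?_
  · refine (totalDegree_sub _ _).trans (max_le (by simp) ?_)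
    refine totalDegree_finsetSum_le fun j _ => (totalDegree_mul _ _).trans ?_
    simp
  · have h : Finsupp.single i 1 ∈ (unitForm ζ).support := by
      rw [mem_support_iff, coeff_single_unitForm]
      exact neg_ne_zero.2 hi
    simpa using le_totalDegree h

theorem prime_unitForm {ζ : ι → K} (hζ : ζ ≠ 0) : Prime (unitForm ζ) := by
  refine (irreducible_of_totalDegree_eq_one (totalDegree_unitForm hζ) fun x hx => ?_).prime
  exact isUnit_of_dvd_one (coeff_zero_unitForm ζ ▸ hx 0)

theorem isRelPrime_unitForm {ζ η : ι → K} (hζ : ζ ≠ 0) (hη : η ≠ 0) (h : ζ ≠ η) :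
    IsRelPrime (unitForm ζ) (unitForm η) := by
  rw [(prime_unitForm hζ).irreducible.isRelPrime_iff_not_dvd]
  rintro ⟨u, hu⟩
  have hunit := ((prime_unitForm hη).irreducible.isUnit_or_isUnit hu).resolve_left
    (prime_unitForm hζ).not_isUnit
  exact h (unitForm_injective (eq_of_mul_isUnit_of_coeff_zero hu hunit
    (coeff_zero_unitForm ζ) (coeff_zero_unitForm η))).symm

/-- The families of `d`-th roots of unity in `K` indexed by `ι`. -/
noncomputable def rootFamilies (ι K : Type*) [Field K] [Fintype ι] [DecidableEq ι] (d : ℕ) :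
    Finset (ι → K) :=
  Fintype.piFinset fun _ => Polynomial.nthRootsFinset d (1 : K)

/-- The product of the forms `1 - ∑ i, ζ i * X i` over all families `ζ` of `d`-th roots of
unity. -/
noncomputable def unitFormProd (ι K : Type*) [Field K] [Fintype ι] [DecidableEq ι] (d : ℕ) :
    MvPolynomial ι K :=
  ∏ ζ ∈ rootFamilies ι K d, unitForm ζ

variable [DecidableEq ι] {d : ℕ}

theorem mem_rootFamilies (hd : 0 < d) {ζ : ι → K} :
    ζ ∈ rootFamilies ι K d ↔ ∀ i, ζ i ^ d = 1 := by
  simp [rootFamilies, Polynomial.mem_nthRootsFinset hd]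

theorem ne_zero_of_mem_rootFamilies [Nonempty ι] (hd : 0 < d) {ζ : ι → K}
    (hζ : ζ ∈ rootFamilies ι K d) : ζ ≠ 0 := by
  rintro rfl
  have h := (mem_rootFamilies hd).1 hζ (Classical.arbitrary ι)
  simp [hd.ne'] at h

theorem card_rootFamilies {ω : K} (hω : IsPrimitiveRoot ω d) :
    (rootFamilies ι K d).card = d ^ Fintype.card ι := by
  simp [rootFamilies, hω.card_nthRootsFinset]

theorem coeff_zero_unitFormProd : (unitFormProd ι K d).coeff 0 = 1 := by
  rw [unitFormProd, ← constantCoeff_eq, map_prod]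
  exact Finset.prod_eq_one fun ζ _ => coeff_zero_unitForm ζ

theorem unitFormProd_ne_zero : unitFormProd ι K d ≠ 0 := fun h => by
  simpa [h] using coeff_zero_unitFormProd (ι := ι) (K := K) (d := d)

theorem totalDegree_unitFormProd [Nonempty ι] (hd : 0 < d) {ω : K} (hω : IsPrimitiveRoot ω d) :
    (unitFormProd ι K d).totalDegree = d ^ Fintype.card ι := by
  classical
  rw [← card_rootFamilies (ι := ι) hω, unitFormProd]
  have key : ∀ s ⊆ rootFamilies ι K d, (∏ ζ ∈ s, unitForm ζ).totalDegree = s.card := by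
    intro s
    induction s using Finset.induction_on with
    | empty => simp
    | insert ζ s hζ ih =>
      intro hs
      obtain ⟨h₁, h₂⟩ := Finset.insert_subset_iff.1 hs
      rw [Finset.prod_insert hζ, Finset.card_insert_of_notMem hζ, totalDegree_mul_of_isDomain,
        ih h₂, totalDegree_unitForm (ne_zero_of_mem_rootFamilies hd h₁), add_comm]
      · exact (prime_unitForm (ne_zero_of_mem_rootFamilies hd h₁)).ne_zero
      · exact Finset.prod_ne_zero_iff.2 fun η hη =>
          (prime_unitForm (ne_zero_of_mem_rootFamilies hd (h₂ hη))).ne_zero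
  exact key _ subset_rfl

theorem scaleVars_unitFormProd (hd : 0 < d) {η : ι → K} (hη : ∀ i, η i ^ d = 1) :
    scaleVars η (unitFormProd ι K d) = unitFormProd ι K d := by
  have hη0 : ∀ i, η i ≠ 0 := fun i h => by simpa [h, hd.ne'] using hη i
  rw [unitFormProd, map_prod]
  refine Finset.prod_nbij' (· * η) (· * η⁻¹) ?_ ?_ ?_ ?_ fun ζ _ => scaleVars_unitForm ζ η
  · simp only [mem_rootFamilies hd]
    exact fun ζ hζ i => by simp [mul_pow, hζ, hη]
  · simp only [mem_rootFamilies hd]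
    exact fun ζ hζ i => by simp [mul_pow, hζ, hη]
  · exact fun ζ _ => funext fun i => by simp [hη0]
  · exact fun ζ _ => funext fun i => by simp [hη0]

theorem map_unitFormProd (hd : 0 < d) (τ : K ≃+* K) :
    map (τ : K →+* K) (unitFormProd ι K d) = unitFormProd ι K d := by
  rw [unitFormProd, map_prod]
  refine Finset.prod_nbij' (τ ∘ ·) (τ.symm ∘ ·) ?_ ?_ ?_ ?_ fun ζ _ => by simp [unitForm]
  · simp only [mem_rootFamilies hd]
    exact fun ζ hζ i => by simp [← map_pow, hζ]
  · simp only [mem_rootFamilies hd]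
    exact fun ζ hζ i => by simp [← map_pow, hζ]
  · exact fun ζ _ => funext fun i => by simp
  · exact fun ζ _ => funext fun i => by simp

/-- A polynomial in the `d`-th powers of the variables which is divisible by `1 - ∑ i, X i` is
divisible by all the conjugates of this form. -/
theorem unitFormProd_dvd_expand [Nonempty ι] (hd : 0 < d) {p : MvPolynomial ι K}
    (h : unitForm 1 ∣ expand d p) : unitFormProd ι K d ∣ expand d p := by
  refine Finset.prod_dvd_of_isRelPrime (fun ζ hζ η hη hne => ?_) fun ζ hζ => ?_
  · exact isRelPrime_unitForm (ne_zero_of_mem_rootFamilies hd hζ)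
      (ne_zero_of_mem_rootFamilies hd hη) hne
  · have := map_dvd (scaleVars ζ) h
    rwa [scaleVars_unitForm, one_mul, scaleVars_expand ((mem_rootFamilies hd).1 hζ)] at this

variable {k : Type*} [Field k] [Algebra k K]

theorem exists_map_expand_eq_unitFormProd [IsGalois k K] (hd : 0 < d) {ω : K}
    (hω : IsPrimitiveRoot ω d) :
    ∃ f : MvPolynomial ι k, map (algebraMap k K) (expand d f) = unitFormProd ι K d :=
  exists_map_expand_eq hω _ (fun _ hζ => scaleVars_unitFormProd hd hζ)
    fun τ => map_unitFormProd hd τ.toRingEquiv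

/-- The polynomial descending `unitFormProd` generates the ideal of all polynomials whose
expansion is divisible by `1 - ∑ i, X i`. -/
theorem dvd_of_unitForm_dvd [IsGalois k K] [Nonempty ι] (hd : 0 < d) {ω : K}
    (hω : IsPrimitiveRoot ω d) {f g : MvPolynomial ι k}
    (hf : map (algebraMap k K) (expand d f) = unitFormProd ι K d)
    (hg : unitForm 1 ∣ map (algebraMap k K) (expand d g)) : f ∣ g := by
  have hG : unitFormProd ι K d ∣ map (algebraMap k K) (expand d g) := by
    rw [map_expand] at hg ⊢
    exact unitFormProd_dvd_expand hd hg
  obtain ⟨H, hH⟩ := hG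
  obtain ⟨h, rfl⟩ := exists_map_expand_eq (k := k) hω H
    (fun ζ hζ => mul_left_cancel₀ (unitFormProd_ne_zero (ι := ι) (K := K) (d := d)) <| by
      conv_lhs => rw [← scaleVars_unitFormProd hd hζ]
      rw [← map_mul, ← hH, map_expand, scaleVars_expand hζ])
    (fun τ => mul_left_cancel₀ (unitFormProd_ne_zero (ι := ι) (K := K) (d := d)) <| by
      have hτ : map (τ : K →+* K) (unitFormProd ι K d) = unitFormProd ι K d :=
        map_unitFormProd hd τ.toRingEquiv
      conv_lhs => rw [← hτ]
      rw [← map_mul, ← hH, map_map]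
      congr 2
      exact τ.toAlgHom.comp_algebraMap)
  refine ⟨h, expand_injective hd (map_injective _ (algebraMap k K).injective ?_)⟩
  rw [hH, ← hf, ← map_mul, ← map_mul]

theorem irreducible_of_map_expand_eq [IsGalois k K] [Nonempty ι] (hd : 0 < d) {ω : K}
    (hω : IsPrimitiveRoot ω d) {f : MvPolynomial ι k}
    (hf : map (algebraMap k K) (expand d f) = unitFormProd ι K d) : Irreducible f := by
  have hf0 : f ≠ 0 := by
    rintro rfl
    exact unitFormProd_ne_zero (by simpa using hf.symm)
  have hprime : Prime (unitForm (1 : ι → K)) := prime_unitForm one_ne_zero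
  have hdvd : unitForm 1 ∣ map (algebraMap k K) (expand d f) := by
    rw [hf]
    exact Finset.dvd_prod_of_mem _ ((mem_rootFamilies hd).2 fun i => one_pow d)
  refine ⟨fun hu => ?_, fun a b hab => ?_⟩
  · exact hprime.not_isUnit (isUnit_of_dvd_unit hdvd ((hu.map (expand d)).map (map _)))
  · rw [hab, map_mul, map_mul] at hdvd
    rcases hprime.dvd_or_dvd hdvd with h | h
    · have h0 := left_ne_zero_of_mul (hab ▸ hf0)
      refine .inr (isUnit_of_dvd_one ((mul_dvd_mul_iff_left h0).1 ?_))
      simpa [← hab] using dvd_of_unitForm_dvd hd hω hf h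
    · have h0 := right_ne_zero_of_mul (hab ▸ hf0)
      refine .inl (isUnit_of_dvd_one ((mul_dvd_mul_iff_right h0).1 ?_))
      simpa [← hab] using dvd_of_unitForm_dvd hd hω hf h

end RadicalForms

/-- A polynomial vanishing at all rational points of the standard simplex is divisible by
`1 - ∑ i, X i`. -/
theorem unitForm_dvd_of_eval_eq_zero {ι : Type*} [Fintype ι] [DecidableEq ι] [Nonempty ι]
    (p : MvPolynomial ι ℚ)
    (hp : ∀ z : ι → ℚ, (∀ i, 0 ≤ z i) → ∑ i, z i = 1 → eval z p = 0) : unitForm 1 ∣ p := by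
  obtain ⟨j⟩ := ‹Nonempty ι›
  let s : ι → MvPolynomial ι ℚ := Function.update X j (1 - ∑ i ∈ Finset.univ.erase j, X i)
  have hmk : (Ideal.Quotient.mkₐ ℚ (Ideal.span {unitForm (1 : ι → ℚ)})).comp (aeval s) =
      Ideal.Quotient.mkₐ ℚ (Ideal.span {unitForm (1 : ι → ℚ)}) := by
    ext1 i
    simp only [AlgHom.comp_apply, aeval_X, s]
    by_cases hi : i = j
    · subst hi
      rw [Function.update_self, Ideal.Quotient.mkₐ_eq_mk, Ideal.Quotient.eq,
        Ideal.mem_span_singleton]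
      refine dvd_of_eq ?_
      simp only [unitForm, Pi.one_apply, C_1, one_mul]
      rw [← Finset.add_sum_erase _ _ (Finset.mem_univ i)]
      ring
    · rw [Function.update_of_ne hi]
  have hzero : aeval s p = 0 := by
    refine funext_set (fun _ => Set.Icc (0 : ℚ) (1 / Fintype.card ι)) (fun _ => ?_) fun z hz => ?_
    · exact Set.Icc_infinite (one_div_pos.2 (Nat.cast_pos.2 (Fintype.card_pos_iff.2 ⟨j⟩)))
    · have hz' : ∀ i, 0 ≤ z i ∧ z i ≤ 1 / Fintype.card ι := fun i => hz i (Set.mem_univ i)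
      have hcomp : eval z (aeval s p) = eval (fun i => eval z (s i)) p := by
        rw [aeval_eq_bind₁]
        exact eval₂Hom_bind₁ (RingHom.id ℚ) z s p
      have hrest : ∑ i ∈ Finset.univ.erase j, z i ≤ 1 := calc
        _ ≤ ∑ i, z i := Finset.sum_le_sum_of_subset_of_nonneg (Finset.erase_subset _ _)
          fun i _ _ => (hz' i).1
        _ ≤ ∑ _i : ι, (1 / Fintype.card ι : ℚ) := Finset.sum_le_sum fun i _ => (hz' i).2
        _ ≤ 1 := by
          rw [Finset.sum_const, Finset.card_univ, nsmul_eq_mul, mul_one_div]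
          exact div_self_le_one _
      have hval : (fun i => eval z (s i)) =
          Function.update z j (1 - ∑ i ∈ Finset.univ.erase j, z i) := by
        funext i
        by_cases hi : i = j
        · subst hi; simp [s]
        · simp [s, hi]
      rw [hcomp, map_zero, hval]
      refine hp _ (fun i => ?_) ?_
      · by_cases hi : i = j
        · subst hi; simpa using hrest
        · simpa [hi] using (hz' i).1
      · rw [← Finset.add_sum_erase _ _ (Finset.mem_univ j), Function.update_self,
          Finset.sum_congr rfl fun i hi => Function.update_of_ne (Finset.ne_of_mem_erase hi) _ _]
        ring
  have h := DFunLike.congr_fun hmk p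
  rw [AlgHom.comp_apply, hzero, map_zero, Ideal.Quotient.mkₐ_eq_mk, eq_comm,
    Ideal.Quotient.eq_zero_iff_mem, Ideal.mem_span_singleton] at h
  exact h

/-- There is a unique irreducible polynomial `f ∈ ℚ[x₁,…,xₙ]` with constant term 1
(of total degree `d^{n-1}`) vanishing on the boundary of the positive part of the
unit ball of `L^{1/d}`, i.e. on `{x : xᵢ ≥ 0, ∑ xᵢ^{1/d} = 1}`. -/
theorem unit_ball_boundary_polynomial (d n : ℕ) (hd : 2 ≤ d) (hn : 2 ≤ n) :
    ∃ f : MvPolynomial (Fin n) ℚ,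
      Irreducible f ∧
      f.totalDegree = d ^ (n - 1) ∧
      MvPolynomial.coeff 0 f = 1 ∧
      (∀ x : Fin n → ℝ, (∀ i, 0 ≤ x i) → ∑ i, x i ^ ((1 : ℝ) / d) = 1 →
        MvPolynomial.aeval x f = 0) ∧
      (∀ g : MvPolynomial (Fin n) ℚ, Irreducible g → MvPolynomial.coeff 0 g = 1 →
        (∀ x : Fin n → ℝ, (∀ i, 0 ≤ x i) → ∑ i, x i ^ ((1 : ℝ) / d) = 1 →
          MvPolynomial.aeval x g = 0) → g = f) := by
  have hd0 : 0 < d := by omega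
  have : NeZero d := ⟨hd0.ne'⟩
  have : Nonempty (Fin n) := ⟨⟨0, by omega⟩⟩
  have : IsGalois ℚ (AlgebraicClosure ℚ) := by
    have : IsAlgClosure ℚ (AlgebraicClosure ℚ) := ⟨inferInstance, AlgebraicClosure.isAlgebraic ℚ⟩
    infer_instance
  obtain ⟨ω, hω⟩ := HasEnoughRootsOfUnity.exists_primitiveRoot (AlgebraicClosure ℚ) d
  obtain ⟨f, hf⟩ := exists_map_expand_eq_unitFormProd (ι := Fin n) (k := ℚ) hd0 hω
  have hirr : Irreducible f := irreducible_of_map_expand_eq hd0 hω hf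
  have hcoeff : f.coeff 0 = 1 := by
    have h := coeff_zero_unitFormProd (ι := Fin n) (K := AlgebraicClosure ℚ) (d := d)
    rw [← hf, coeff_map, coeff_expand_zero d hd0.ne'] at h
    exact (algebraMap ℚ (AlgebraicClosure ℚ)).injective (h.trans (map_one _).symm)
  refine ⟨f, hirr, ?_, hcoeff, fun x hx hsum => ?_, fun g hg hg1 hgx => ?_⟩
  · have h := totalDegree_unitFormProd (ι := Fin n) hd0 hω
    rw [← hf, totalDegree,
      support_map_of_injective _ (algebraMap ℚ (AlgebraicClosure ℚ)).injective,
      ← totalDegree, totalDegree_expand, Fintype.card_fin] at h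
    refine Nat.eq_of_mul_eq_mul_right hd0 (h.trans ?_)
    rw [← pow_succ, Nat.sub_add_cancel (by omega)]
  · let φ : AlgebraicClosure ℚ →ₐ[ℚ] ℂ := IsAlgClosed.lift
    let y : Fin n → ℂ := fun i => ((x i ^ ((1 : ℝ) / d) : ℝ) : ℂ)
    have hy : y ^ d = fun i => algebraMap ℝ ℂ (x i) := by
      funext i
      simp only [y, Pi.pow_apply, ← Complex.ofReal_pow, one_div,
        Real.rpow_inv_natCast_pow (hx i) hd0.ne']
      rfl
    have h0 : eval₂ (φ : AlgebraicClosure ℚ →+* ℂ) y (unitFormProd (Fin n) _ d) = 0 := by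
      rw [unitFormProd, eval₂_prod]
      refine Finset.prod_eq_zero ((mem_rootFamilies hd0).2 fun i => one_pow d) ?_
      have hsum' : ∑ i, y i = 1 := by rw [← Complex.ofReal_sum, hsum, Complex.ofReal_one]
      simp [unitForm, eval₂_sub, eval₂_sum, hsum']
    rw [← hf, eval₂_map, φ.comp_algebraMap, eval₂_expand, hy, ← aeval_def] at h0
    refine (algebraMap ℝ ℂ).injective ?_
    rw [map_zero, ← h0]
    exact (aeval_algebraMap_apply ℂ x f).symm
  · have hdvd : unitForm 1 ∣ expand d g := by
      refine unitForm_dvd_of_eval_eq_zero _ fun z hz hz1 => ?_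
      have h := hgx (algebraMap ℚ ℝ ∘ (z ^ d)) (fun i => ?_) ?_
      · rw [aeval_algebraMap_apply, map_eq_zero_iff _ (algebraMap ℚ ℝ).injective] at h
        rw [eval_expand]
        exact h
      · simpa using pow_nonneg (Rat.cast_nonneg.2 (hz i)) d
      · simp only [Function.comp_apply, Pi.pow_apply, map_pow, one_div, eq_ratCast,
          Real.pow_rpow_inv_natCast (Rat.cast_nonneg.2 (hz _)) hd0.ne']
        exact_mod_cast hz1
    have hdvd' := map_dvd (map (algebraMap ℚ (AlgebraicClosure ℚ))) hdvd
    have h1 : map (algebraMap ℚ (AlgebraicClosure ℚ)) (unitForm (1 : Fin n → ℚ)) = unitForm 1 := by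
      simp [unitForm]
    rw [h1] at hdvd'
    obtain ⟨u, hu⟩ := dvd_of_unitForm_dvd hd0 hω hf hdvd'
    exact eq_of_mul_isUnit_of_coeff_zero hu
      ((hg.isUnit_or_isUnit hu).resolve_left hirr.not_isUnit) hcoeff hg1
end
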